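/- arXiv:2003.05300 — 5 statements merged into one kernel-verified Lean document; each statement's English description precedes it below -/
import Mathlib

section
/- For every t > 0 one has ψ'(t) > 1/t + 1/(2t^2) + 1/(6t^3) − 1/(30t^5); equivalently, Q(t) > 0 on (0, ∞). -/
open Real Set Filter Topology

/-- The trigamma function `ψ'(t) = ∑_{n=0}^∞ 1/(t+n)^2`. -/
noncomputable def trigamma (t : ℝ) : ℝ := ∑' n : ℕ, 1 / (t + n) ^ 2

/-- `Q(t) = ψ'(t) − 1/t − 1/(2t²) − 1/(6t³) + 1/(30t⁵)`. -/
noncomputable def Q (t : ℝ) : ℝ :=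
  trigamma t - 1 / t - 1 / (2 * t ^ 2) - 1 / (6 * t ^ 3) + 1 / (30 * t ^ 5)

/-- A function is completely monotonic on `(0, ∞)` if it is infinitely differentiable there
and `(−1)ⁿ f⁽ⁿ⁾(t) ≥ 0` for all `n ≥ 0` and `t > 0`. -/
def CompletelyMonotonicOn (f : ℝ → ℝ) : Prop :=
  ContDiffOn ℝ (⊤ : ℕ∞) f (Ioi 0) ∧
    ∀ n : ℕ, ∀ t : ℝ, 0 < t → 0 ≤ (-1 : ℝ) ^ n * iteratedDeriv n f t

/-- The truncated asymptotic expansion of the trigamma function at infinity. -/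
noncomputable def trigammaExpansion (t : ℝ) : ℝ :=
  1 / t + 1 / (2 * t ^ 2) + 1 / (6 * t ^ 3) - 1 / (30 * t ^ 5)

theorem trigammaExpansion_lt {t : ℝ} (ht : 0 < t) :
    trigammaExpansion t < 1 / t ^ 2 + trigammaExpansion (t + 1) := by
  have key : 1 / t ^ 2 + trigammaExpansion (t + 1) - trigammaExpansion t
      = (5 * t ^ 2 + 5 * t + 1) / (30 * t ^ 5 * (t + 1) ^ 5) := by
    unfold trigammaExpansion
    field_simp
    ring
  have hpos : 0 < (5 * t ^ 2 + 5 * t + 1) / (30 * t ^ 5 * (t + 1) ^ 5) := by positivity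
  linarith

theorem tendsto_trigammaExpansion : Tendsto trigammaExpansion atTop (𝓝 0) := by
  have h : Tendsto (fun t : ℝ ↦ t⁻¹) atTop (𝓝 0) := tendsto_inv_atTop_zero
  have h' := ((h.add ((h.pow 2).const_mul (1 / 2))).add ((h.pow 3).const_mul (1 / 6))).sub
    ((h.pow 5).const_mul (1 / 30))
  norm_num at h'
  refine h'.congr fun t ↦ ?_
  simp only [trigammaExpansion, one_div, mul_inv]

theorem summable_trigamma {t : ℝ} (ht : 0 < t) :
    Summable fun n : ℕ ↦ 1 / (t + n) ^ 2 := by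
  refine ((Real.summable_one_div_nat_add_rpow t 2).2 one_lt_two).congr fun n ↦ ?_
  rw [abs_of_pos (by positivity), add_comm, Real.rpow_two]

theorem trigamma_add_one {t : ℝ} (ht : 0 < t) :
    trigamma t = 1 / t ^ 2 + trigamma (t + 1) := by
  unfold trigamma
  rw [(summable_trigamma ht).tsum_eq_zero_add]
  simp [add_assoc, add_comm (1 : ℝ)]

theorem trigammaExpansion_le_sum_add {t : ℝ} (ht : 0 < t) (N : ℕ) :
    trigammaExpansion t
      ≤ ∑ n ∈ Finset.range N, 1 / (t + n) ^ 2 + trigammaExpansion (t + N) := by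
  induction N with
  | zero => simp
  | succ N ih =>
    have h := trigammaExpansion_lt (t := t + N) (by positivity)
    rw [Finset.sum_range_succ]
    push_cast
    rw [← add_assoc t]
    linarith

theorem trigammaExpansion_le_trigamma {t : ℝ} (ht : 0 < t) :
    trigammaExpansion t ≤ trigamma t := by
  have h := (summable_trigamma ht).hasSum.tendsto_sum_nat.add
    (tendsto_trigammaExpansion.comp
      (tendsto_atTop_add_const_left _ t tendsto_natCast_atTop_atTop))
  rw [add_zero] at h
  exact ge_of_tendsto' h (trigammaExpansion_le_sum_add ht)

/-- For every `t > 0`, `ψ'(t) > 1/t + 1/(2t²) + 1/(6t³) − 1/(30t⁵)`; equivalently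
`Q(t) > 0` on `(0, ∞)`. -/
theorem trigamma_gt (t : ℝ) (ht : 0 < t) :
    1 / t + 1 / (2 * t ^ 2) + 1 / (6 * t ^ 3) - 1 / (30 * t ^ 5) < trigamma t := by
  have h := trigammaExpansion_le_trigamma (t := t + 1) (by positivity)
  calc trigammaExpansion t < 1 / t ^ 2 + trigammaExpansion (t + 1) := trigammaExpansion_lt ht
    _ ≤ 1 / t ^ 2 + trigamma (t + 1) := by gcongr
    _ = trigamma t := (trigamma_add_one ht).symm
end

section
/- For every t > 0, Q(t) = ∫_0^∞ h(s) e^{−ts} ds, where h(s) = s/(1 − e^{−s}) − 1 − s/2 − s^2/12 + s^4/720. -/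
open Real Set Filter Topology

/-- `h(s) = s/(1 − e^{−s}) − 1 − s/2 − s²/12 + s⁴/720`. -/
noncomputable def hfun (s : ℝ) : ℝ :=
  s / (1 - Real.exp (-s)) - 1 - s / 2 - s ^ 2 / 12 + s ^ 4 / 720

open MeasureTheory in
theorem integral_pow_mul_exp_neg_mul_Ioi (k : ℕ) {r : ℝ} (hr : 0 < r) :
    ∫ s in Ioi (0 : ℝ), s ^ k * Real.exp (-r * s) = k.factorial / r ^ (k + 1) := by
  have h := Real.integral_rpow_mul_exp_neg_mul_Ioi (a := (k : ℝ) + 1) (by positivity) hr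
  have h1 : (1 / r) ^ ((k : ℝ) + 1) = (1 / r) ^ (k + 1) := by
    exact_mod_cast Real.rpow_natCast (1 / r) (k + 1)
  rw [Real.Gamma_nat_eq_factorial, h1] at h
  simp only [add_sub_cancel_right, Real.rpow_natCast] at h
  simp only [neg_mul, h]
  rw [one_div_pow, one_div, div_eq_inv_mul]

open MeasureTheory in
theorem integrableOn_pow_mul_exp_neg_mul_Ioi (k : ℕ) {r : ℝ} (hr : 0 < r) :
    IntegrableOn (fun s : ℝ => s ^ k * Real.exp (-r * s)) (Ioi 0) :=
  .of_integral_ne_zero (by rw [integral_pow_mul_exp_neg_mul_Ioi k hr]; positivity)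

theorem summable_one_div_add_nat_sq (t : ℝ) :
    Summable fun n : ℕ => 1 / (t + n) ^ 2 := by
  have h := (Real.summable_one_div_nat_add_rpow t 2).2 (by norm_num)
  refine h.congr fun n => ?_
  rw [show (2 : ℝ) = (2 : ℕ) by norm_num, Real.rpow_natCast, sq_abs, add_comm]

theorem trigamma_pos {t : ℝ} (ht : 0 < t) : 0 < trigamma t :=
  (summable_one_div_add_nat_sq t).tsum_pos (fun n => by positivity) 0 (by positivity)

/-- Expansion of the trigamma integrand as a geometric series. -/
theorem tsum_mul_exp_neg_add_nat_mul (t : ℝ) {s : ℝ} (hs : 0 < s) :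
    ∑' n : ℕ, s ^ 1 * Real.exp (-(t + n) * s) =
      s / (1 - Real.exp (-s)) * Real.exp (-t * s) := by
  have h : ∀ n : ℕ, s ^ 1 * Real.exp (-(t + n) * s) =
      s * Real.exp (-t * s) * Real.exp (-s) ^ n := by
    intro n
    rw [← Real.exp_nat_mul, pow_one, mul_assoc, ← Real.exp_add]
    congr 2
    ring
  simp_rw [h]
  rw [tsum_mul_left, tsum_geometric_of_lt_one (Real.exp_pos _).le
    (Real.exp_lt_one_iff.2 (by linarith))]
  ring

open MeasureTheory in
theorem trigamma_eq_integral {t : ℝ} (ht : 0 < t) :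
    trigamma t =
      ∫ s in Ioi (0 : ℝ), s / (1 - Real.exp (-s)) * Real.exp (-t * s) := by
  have hpos : ∀ n : ℕ, 0 < t + n := fun n => by positivity
  have hint : ∀ n : ℕ, ∫ s in Ioi (0 : ℝ), s ^ 1 * Real.exp (-(t + n) * s) =
      1 / (t + n) ^ 2 := fun n => by
    simpa using integral_pow_mul_exp_neg_mul_Ioi 1 (hpos n)
  have hnorm : ∀ n : ℕ, ∫ s in Ioi (0 : ℝ), ‖s ^ 1 * Real.exp (-(t + n) * s)‖ =
      1 / (t + n) ^ 2 := fun n => by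
    rw [← hint n]
    refine setIntegral_congr_fun measurableSet_Ioi fun s (hs : 0 < s) => ?_
    exact Real.norm_of_nonneg (by positivity)
  have h := hasSum_integral_of_summable_integral_norm
    (fun n : ℕ => integrableOn_pow_mul_exp_neg_mul_Ioi 1 (hpos n))
    ((summable_one_div_add_nat_sq t).congr fun n => (hnorm n).symm)
  simp_rw [hint] at h
  rw [trigamma, h.tsum_eq]
  exact setIntegral_congr_fun measurableSet_Ioi fun s hs => tsum_mul_exp_neg_add_nat_mul t hs

open MeasureTheory in
theorem integrableOn_div_one_sub_exp_neg_mul_exp {t : ℝ} (ht : 0 < t) :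
    IntegrableOn (fun s : ℝ => s / (1 - Real.exp (-s)) * Real.exp (-t * s)) (Ioi 0) :=
  .of_integral_ne_zero (by rw [← trigamma_eq_integral ht]; exact (trigamma_pos ht).ne')

/-- For every `t > 0`, `Q(t) = ∫₀^∞ h(s) e^{−ts} ds`. -/
theorem Q_eq_integral (t : ℝ) (ht : 0 < t) :
    Q t = ∫ s in Ioi (0 : ℝ), hfun s * Real.exp (-t * s) := by
  have hI := integrableOn_div_one_sub_exp_neg_mul_exp ht
  have hP := fun k : ℕ => integrableOn_pow_mul_exp_neg_mul_Ioi k ht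
  have hsplit : ∀ s : ℝ, hfun s * Real.exp (-t * s) =
      s / (1 - Real.exp (-s)) * Real.exp (-t * s) - s ^ 0 * Real.exp (-t * s)
        - 1 / 2 * (s ^ 1 * Real.exp (-t * s)) - 1 / 12 * (s ^ 2 * Real.exp (-t * s))
        + 1 / 720 * (s ^ 4 * Real.exp (-t * s)) := fun s => by
    rw [hfun]
    ring
  simp_rw [hsplit]
  have h0 := hI.fun_sub (hP 0)
  have h1 := h0.fun_sub ((hP 1).const_mul (1 / 2))
  have h2 := h1.fun_sub ((hP 2).const_mul (1 / 12))
  rw [MeasureTheory.integral_add h2 ((hP 4).const_mul _),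
    MeasureTheory.integral_sub h1 ((hP 2).const_mul _),
    MeasureTheory.integral_sub h0 ((hP 1).const_mul _),
    MeasureTheory.integral_sub hI (hP 0)]
  simp only [MeasureTheory.integral_const_mul, integral_pow_mul_exp_neg_mul_Ioi _ ht,
    ← trigamma_eq_integral ht, Q, Nat.factorial]
  push_cast
  field_simp
  ring
end

section
/- For every s > 0, the inequality e^{5s} + 5(6s − 25)e^{4s} + 10(33s − 35)e^{3s} + 10(33s + 35)e^{2s} + 5(6s + 25)e^{s} − 1 > 0 holds. -/
open Real

/-- The power series of `exp (k * s)`, with the coefficients written over `n!`. -/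
lemma hasSum_exp_mul (k s : ℝ) :
    HasSum (fun n : ℕ => k ^ n * (s ^ n / n.factorial)) (Real.exp (k * s)) := by
  have h := NormedSpace.expSeries_div_hasSum_exp (k * s)
  rw [← Real.exp_eq_exp_ℝ] at h
  refine h.congr_fun fun n => ?_
  rw [mul_pow, mul_div_assoc]

/-- The power series of `s * exp (k * s)`, with the coefficients written over `n!`. -/
lemma hasSum_mul_exp_mul (k s : ℝ) :
    HasSum (fun n : ℕ => (n * k ^ (n - 1)) * (s ^ n / n.factorial)) (s * Real.exp (k * s)) := by
  rw [← hasSum_nat_add_iff' 1]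
  simp only [Finset.range_one, Finset.sum_singleton, Nat.cast_zero, zero_mul, sub_zero]
  refine ((hasSum_exp_mul k s).mul_left s).congr_fun fun n => ?_
  have hn : (n.factorial : ℝ) ≠ 0 := by positivity
  have hn' : (n : ℝ) + 1 ≠ 0 := by positivity
  rw [Nat.factorial_succ, Nat.add_sub_cancel]
  push_cast
  field_simp
  ring

/-- The coefficient of `s ^ n / n!` in the power series of the exponential combination. -/
noncomputable def expCombinationCoeff (n : ℕ) : ℝ :=
  5 ^ n + (30 * (n * 4 ^ (n - 1)) - 125 * 4 ^ n) + (330 * (n * 3 ^ (n - 1)) - 350 * 3 ^ n)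
    + (330 * (n * 2 ^ (n - 1)) + 350 * 2 ^ n) + (30 * (n * 1 ^ (n - 1)) + 125 * 1 ^ n) - 0 ^ n

lemma expCombinationCoeff_nonneg (n : ℕ) : 0 ≤ expCombinationCoeff n := by
  unfold expCombinationCoeff
  rcases lt_or_ge n 17 with h | h
  · interval_cases n <;> norm_num
  · obtain ⟨m, rfl⟩ := Nat.exists_eq_add_of_le' h
    have h4 : (0 : ℝ) < 4 ^ (m + 16) := by positivity
    have h3 : (0 : ℝ) < 3 ^ (m + 16) := by positivity
    have h2 : (0 : ℝ) < 2 ^ (m + 16) := by positivity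
    have h5 : (0 : ℝ) < 5 ^ (m + 17) := by positivity
    have hm : (0 : ℝ) ≤ m := m.cast_nonneg
    have e : m + 17 - 1 = m + 16 := rfl
    rw [e, zero_pow (by omega), pow_succ 4 (m + 16), pow_succ 3 (m + 16), pow_succ 2 (m + 16)]
    push_cast
    simp only [one_pow]
    nlinarith [mul_nonneg hm h4.le, mul_nonneg hm h3.le, mul_nonneg hm h2.le]

lemma hasSum_expCombination (s : ℝ) :
    HasSum (fun n : ℕ => expCombinationCoeff n * (s ^ n / n.factorial))
      (Real.exp (5 * s) + 5 * (6 * s - 25) * Real.exp (4 * s)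
        + 10 * (33 * s - 35) * Real.exp (3 * s) + 10 * (33 * s + 35) * Real.exp (2 * s)
        + 5 * (6 * s + 25) * Real.exp s - 1) := by
  have h (a b k : ℝ) := ((hasSum_mul_exp_mul k s).mul_left a).add ((hasSum_exp_mul k s).mul_left b)
  have key := (((((hasSum_exp_mul 5 s).add (h 30 (-125) 4)).add (h 330 (-350) 3)).add
    (h 330 350 2)).add (h 30 125 1)).sub (hasSum_exp_mul 0 s)
  rw [zero_mul, Real.exp_zero, one_mul] at key
  have hval : HasSum (fun n : ℕ => expCombinationCoeff n * (s ^ n / n.factorial)) _ :=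
    key.congr_fun fun n => by
      unfold expCombinationCoeff
      ring
  convert hval using 1
  ring

/-- For every `s > 0`,
`e^{5s} + 5(6s−25)e^{4s} + 10(33s−35)e^{3s} + 10(33s+35)e^{2s} + 5(6s+25)eˢ − 1 > 0`. -/
theorem exp_combination_pos (s : ℝ) (hs : 0 < s) :
    0 < Real.exp (5 * s) + 5 * (6 * s - 25) * Real.exp (4 * s)
      + 10 * (33 * s - 35) * Real.exp (3 * s) + 10 * (33 * s + 35) * Real.exp (2 * s)
      + 5 * (6 * s + 25) * Real.exp s - 1 := by
  have nonneg (n : ℕ) : 0 ≤ expCombinationCoeff n * (s ^ n / n.factorial) :=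
    mul_nonneg (expCombinationCoeff_nonneg n) (by positivity)
  refine lt_of_lt_of_le ?_ (le_hasSum (hasSum_expCombination s) 7 fun n _ => nonneg n)
  have h7 : expCombinationCoeff 7 = 1800 := by
    norm_num [expCombinationCoeff]
  rw [h7]
  positivity
end

section
/- For every real ε > 1, the function t ↦ t^{4+ε} · Q(t) is not completely monotonic on (0, ∞). -/
open Real Set Filter Topology

theorem summable_one_div_one_add_sq : Summable fun n : ℕ => 1 / ((1 : ℝ) + n) ^ 2 := by
  have h := (summable_nat_add_iff 1).2 (Real.summable_one_div_nat_pow.2 one_lt_two)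
  simpa [add_comm] using h

theorem trigamma_nonneg (t : ℝ) : 0 ≤ trigamma t :=
  tsum_nonneg fun _ => by positivity

theorem trigamma_le_trigamma_one_div_sq {t : ℝ} (ht : 0 < t) (ht1 : t ≤ 1) :
    trigamma t ≤ trigamma 1 / t ^ 2 := by
  have hle (n : ℕ) : 1 / (t + n) ^ 2 ≤ 1 / ((1 : ℝ) + n) ^ 2 / t ^ 2 := by
    rw [div_div, ← mul_pow]
    have hn : (0 : ℝ) ≤ n := n.cast_nonneg
    gcongr
    nlinarith
  have hs := summable_one_div_one_add_sq.div_const (t ^ 2)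
  calc trigamma t ≤ ∑' n : ℕ, 1 / ((1 : ℝ) + n) ^ 2 / t ^ 2 :=
        (Summable.of_nonneg_of_le (fun _ => by positivity) hle hs).tsum_le_tsum hle hs
    _ = trigamma 1 / t ^ 2 := tsum_div_const

theorem pow_five_mul_Q_le {t : ℝ} (ht : 0 < t) (ht1 : t ≤ 1) :
    t ^ 5 * Q t ≤ trigamma 1 + 1 := by
  have hQ : Q t ≤ trigamma 1 / t ^ 2 + 1 / (30 * t ^ 5) := by
    have h1 : 0 ≤ 1 / t := by positivity
    have h2 : 0 ≤ 1 / (2 * t ^ 2) := by positivity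
    have h3 : 0 ≤ 1 / (6 * t ^ 3) := by positivity
    have := trigamma_le_trigamma_one_div_sq ht ht1
    unfold Q
    linarith
  calc t ^ 5 * Q t ≤ t ^ 5 * (trigamma 1 / t ^ 2 + 1 / (30 * t ^ 5)) := by gcongr
    _ = t ^ 3 * trigamma 1 + 1 / 30 := by field_simp
    _ ≤ 1 * trigamma 1 + 1 := by
        gcongr
        · exact trigamma_nonneg 1
        · exact pow_le_one₀ ht.le ht1
        · norm_num
    _ = trigamma 1 + 1 := by rw [one_mul]

theorem Q_one_div_ten_pos : 0 < Q (1 / 10) := by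
  have := trigamma_nonneg (1 / 10)
  unfold Q
  norm_num at this ⊢
  linarith

theorem CompletelyMonotonicOn.antitoneOn {f : ℝ → ℝ} (hf : CompletelyMonotonicOn f) :
    AntitoneOn f (Ioi 0) := by
  have hd : DifferentiableOn ℝ f (Ioi 0) := hf.1.differentiableOn (by simp)
  refine antitoneOn_of_deriv_nonpos (convex_Ioi 0) hd.continuousOn
    (hd.mono interior_subset) fun x hx => ?_
  rw [interior_Ioi] at hx
  have := hf.2 1 x hx
  rw [iteratedDeriv_one] at this
  linarith

/-- For every real `ε > 1`, the function `t ↦ t^{4+ε} · Q(t)` is not completely monotonic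
on `(0, ∞)`. -/
theorem not_completelyMonotonic_of_one_lt (ε : ℝ) (hε : 1 < ε) :
    ¬ CompletelyMonotonicOn (fun t : ℝ => t ^ ((4 : ℝ) + ε) * Q t) := by
  intro h
  set f : ℝ → ℝ := fun t => t ^ ((4 : ℝ) + ε) * Q t with hf
  have hpos : 0 < f (1 / 10) := mul_pos (by positivity) Q_one_div_ten_pos
  have hlim : Tendsto (fun t : ℝ => t ^ (ε - 1) * (trigamma 1 + 1)) (𝓝[>] 0) (𝓝 0) := by
    have hc : ContinuousAt (fun t : ℝ => t ^ (ε - 1)) 0 :=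
      Real.continuousAt_rpow_const 0 (ε - 1) (Or.inr (by linarith))
    have := (hc.tendsto.mono_left (nhdsWithin_le_nhds (s := Ioi 0))).mul_const (trigamma 1 + 1)
    rwa [Real.zero_rpow (by linarith), zero_mul] at this
  have hle : f (1 / 10) ≤ 0 := by
    refine ge_of_tendsto hlim ?_
    filter_upwards [Ioo_mem_nhdsGT (show (0 : ℝ) < 1 / 10 by norm_num)] with t ht
    have ht0 : 0 < t := ht.1
    calc f (1 / 10) ≤ f t := h.antitoneOn ht0 (by norm_num) ht.2.le
      _ = t ^ (ε - 1) * (t ^ 5 * Q t) := by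
        have hadd : (4 : ℝ) + ε = ε - 1 + (5 : ℕ) := by
          push_cast
          ring
        simp only [hf]
        rw [hadd, Real.rpow_add_natCast ht0.ne', mul_assoc]
      _ ≤ t ^ (ε - 1) * (trigamma 1 + 1) := by
        gcongr
        exact pow_five_mul_Q_le ht0 (by linarith [ht.2])
  exact hpos.not_ge hle
end

section
/- The function t ↦ t^4 · Q(t) is nonincreasing and convex on (0, ∞), and all of its even-order derivatives are nonnegative while all of its odd-order derivatives are nonpositive on (0, ∞). -/
open Real Set Filter Topology

/-- The exponential generating function `x / (eˣ - 1)` of the Bernoulli numbers, extended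
analytically through `x = 0`. -/
noncomputable def bernoulliGen (x : ℝ) : ℝ := (dslope Real.exp 0 x)⁻¹

lemma dslope_exp_mul (x : ℝ) : dslope Real.exp 0 x * x = Real.exp x - 1 := by
  simpa [mul_comm] using sub_smul_dslope Real.exp 0 x

lemma exp_sub_one_ne_zero {x : ℝ} (hx : x ≠ 0) : Real.exp x - 1 ≠ 0 := by
  simpa [sub_eq_zero] using hx

lemma dslope_exp_ne_zero (x : ℝ) : dslope Real.exp 0 x ≠ 0 := by
  rcases eq_or_ne x 0 with rfl | hx
  · simp
  · intro h
    have := dslope_exp_mul x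
    rw [h, zero_mul] at this
    exact exp_sub_one_ne_zero hx this.symm

lemma analyticAt_dslope_exp (x : ℝ) : AnalyticAt ℝ (dslope Real.exp 0) x := by
  rcases eq_or_ne x 0 with rfl | hx
  · obtain ⟨p, hp⟩ : AnalyticAt ℝ Real.exp 0 := by fun_prop
    exact ⟨_, hp.has_fpower_series_dslope_fslope⟩
  · refine AnalyticAt.congr ?_ (dslope_eventuallyEq_slope_of_ne Real.exp hx).symm
    simp only [slope_fun_def, smul_eq_mul, vsub_eq_sub]
    have : x - 0 ≠ 0 := by simpa using hx
    fun_prop (disch := assumption)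

lemma contDiff_bernoulliGen {n : WithTop ℕ∞} : ContDiff ℝ n bernoulliGen :=
  contDiff_iff_contDiffAt.2 fun x =>
    ((analyticAt_dslope_exp x).inv (dslope_exp_ne_zero x)).contDiffAt

lemma bernoulliGen_mul (x : ℝ) : bernoulliGen x * (Real.exp x - 1) = x := by
  rw [← dslope_exp_mul, bernoulliGen, inv_mul_cancel_left₀ (dslope_exp_ne_zero x)]

lemma bernoulliGen_of_ne {x : ℝ} (hx : x ≠ 0) : bernoulliGen x = x * (Real.exp x - 1)⁻¹ :=
  (eq_mul_inv_iff_mul_eq₀ (exp_sub_one_ne_zero hx)).2 (bernoulliGen_mul x)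

lemma iteratedDeriv_exp_sub_one (n : ℕ) :
    iteratedDeriv n (fun x => Real.exp x - 1) 0 = if n = 0 then 0 else 1 := by
  rcases n with _ | n
  · simp
  · rw [iteratedDeriv_succ']
    simp [iteratedDeriv_eq_iterate]

/-- The recursion of the Bernoulli numbers for the derivatives of `bernoulliGen` at `0`. -/
lemma sum_choose_mul_iteratedDeriv_bernoulliGen (n : ℕ) :
    ∑ k ∈ Finset.range (n + 1), (n.choose k : ℝ) * iteratedDeriv k bernoulliGen 0 *
      (if n - k = 0 then 0 else 1) = if n = 1 then 1 else 0 := by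
  have h : iteratedDeriv n (fun x => bernoulliGen x * (Real.exp x - 1)) 0 =
      iteratedDeriv n (fun x : ℝ => x) 0 := by simp only [bernoulliGen_mul]
  rw [iteratedDeriv_fun_mul contDiff_bernoulliGen.contDiffAt (by fun_prop)] at h
  simp only [iteratedDeriv_exp_sub_one] at h
  rw [h]
  rcases n with _ | _ | n
  · simp
  · simp [iteratedDeriv_one]
  · simp [iteratedDeriv_succ', deriv_id'', iteratedDeriv_const]

lemma iteratedDeriv_bernoulliGen_zero :
    bernoulliGen 0 = 1 ∧ iteratedDeriv 1 bernoulliGen 0 = -1 / 2 ∧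
      iteratedDeriv 2 bernoulliGen 0 = 1 / 6 ∧ iteratedDeriv 3 bernoulliGen 0 = 0 := by
  have h0 := sum_choose_mul_iteratedDeriv_bernoulliGen 1
  have h1 := sum_choose_mul_iteratedDeriv_bernoulliGen 2
  have h2 := sum_choose_mul_iteratedDeriv_bernoulliGen 3
  have h3 := sum_choose_mul_iteratedDeriv_bernoulliGen 4
  simp [Finset.sum_range_succ, Nat.choose] at h0 h1 h2 h3
  simp only [iteratedDeriv_one] at *
  refine ⟨?_, ?_, ?_, ?_⟩ <;> linarith

lemma hasDerivAt_iteratedDeriv_bernoulliGen (n : ℕ) (x : ℝ) :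
    HasDerivAt (iteratedDeriv n bernoulliGen) (iteratedDeriv (n + 1) bernoulliGen x) x := by
  rw [iteratedDeriv_succ]
  exact ((contDiff_bernoulliGen (n := (⊤ : ℕ∞))).differentiable_iteratedDeriv n
    (by exact_mod_cast ENat.natCast_lt_top n) x).hasDerivAt

lemma hasDerivAt_inv_exp_sub_one {x : ℝ} (hx : x ≠ 0) :
    HasDerivAt (fun x => (Real.exp x - 1)⁻¹)
      (-((Real.exp x - 1)⁻¹ + (Real.exp x - 1)⁻¹ ^ 2)) x := by
  have h := exp_sub_one_ne_zero hx
  convert! ((Real.hasDerivAt_exp x).sub_const 1).inv h using 1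
  field_simp
  ring

lemma iteratedDeriv_succ_bernoulliGen_of_pos {n : ℕ} {F : ℝ → ℝ} {F' : ℝ}
    (h : ∀ x > 0, iteratedDeriv n bernoulliGen x = F x) {x : ℝ} (hx : 0 < x)
    (hF : HasDerivAt F F' x) : iteratedDeriv (n + 1) bernoulliGen x = F' :=
  (hasDerivAt_iteratedDeriv_bernoulliGen n x).unique <| hF.congr_of_eventuallyEq <| by
    filter_upwards [Ioi_mem_nhds hx] with y hy using h y hy

section

open Polynomial

/-- On the positive axis each derivative of `bernoulliGen` has the form `x A(p) + B(p)` with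
polynomials `A`, `B` in `p = 1 / (eˣ - 1)`. -/
lemma exists_iteratedDeriv_bernoulliGen_of_pos (n : ℕ) : ∃ A B : ℝ[X], ∀ x > 0,
    iteratedDeriv n bernoulliGen x =
      x * A.eval (Real.exp x - 1)⁻¹ + B.eval (Real.exp x - 1)⁻¹ := by
  induction n with
  | zero => exact ⟨X, 0, fun x hx => by simp [bernoulliGen_of_ne hx.ne']⟩
  | succ n ih =>
    obtain ⟨A, B, h⟩ := ih
    refine ⟨-derivative A * (X + X ^ 2), A - derivative B * (X + X ^ 2), fun x hx => ?_⟩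
    have hp := hasDerivAt_inv_exp_sub_one hx.ne'
    refine iteratedDeriv_succ_bernoulliGen_of_pos h hx ?_
    convert! ((hasDerivAt_id x).mul ((A.hasDerivAt _).comp x hp)).add
      ((B.hasDerivAt _).comp x hp) using 1
    simp
    ring

end

lemma iteratedDeriv_four_bernoulliGen_of_pos {x : ℝ} (hx : 0 < x) :
    iteratedDeriv 4 bernoulliGen x =
      (fun p : ℝ => x * (p + 15 * p ^ 2 + 50 * p ^ 3 + 60 * p ^ 4 + 24 * p ^ 5)
        - 4 * (p + 7 * p ^ 2 + 12 * p ^ 3 + 6 * p ^ 4)) (Real.exp x - 1)⁻¹ := by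
  have h0 : ∀ x > 0, iteratedDeriv 0 bernoulliGen x = x * (Real.exp x - 1)⁻¹ := fun x hx => by
    simp [bernoulliGen_of_ne hx.ne']
  have h1 : ∀ x > 0, iteratedDeriv 1 bernoulliGen x =
      (fun p : ℝ => p - x * (p + p ^ 2)) (Real.exp x - 1)⁻¹ := fun x hx => by
    have hp := hasDerivAt_inv_exp_sub_one hx.ne'
    refine iteratedDeriv_succ_bernoulliGen_of_pos h0 hx ?_
    convert! (hasDerivAt_id x).mul hp using 1
    simp [-inv_pow]
    generalize (Real.exp x - 1)⁻¹ = p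
    ring
  have h2 : ∀ x > 0, iteratedDeriv 2 bernoulliGen x =
      (fun p : ℝ => -2 * (p + p ^ 2) + x * (p + 3 * p ^ 2 + 2 * p ^ 3))
        (Real.exp x - 1)⁻¹ := fun x hx => by
    have hp := hasDerivAt_inv_exp_sub_one hx.ne'
    refine iteratedDeriv_succ_bernoulliGen_of_pos h1 hx ?_
    convert! hp.sub ((hasDerivAt_id x).mul (hp.add (hp.pow 2))) using 1
    simp [-inv_pow]
    generalize (Real.exp x - 1)⁻¹ = p
    ring
  have h3 : ∀ x > 0, iteratedDeriv 3 bernoulliGen x =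
      (fun p : ℝ => 3 * (p + 3 * p ^ 2 + 2 * p ^ 3)
        - x * (p + 7 * p ^ 2 + 12 * p ^ 3 + 6 * p ^ 4)) (Real.exp x - 1)⁻¹ := fun x hx => by
    have hp := hasDerivAt_inv_exp_sub_one hx.ne'
    refine iteratedDeriv_succ_bernoulliGen_of_pos h2 hx ?_
    convert! ((hp.add (hp.pow 2)).const_mul (-2)).add ((hasDerivAt_id x).mul
      ((hp.add ((hp.pow 2).const_mul 3)).add ((hp.pow 3).const_mul 2))) using 1
    simp [-inv_pow]
    generalize (Real.exp x - 1)⁻¹ = p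
    ring
  have hp := hasDerivAt_inv_exp_sub_one hx.ne'
  refine iteratedDeriv_succ_bernoulliGen_of_pos h3 hx ?_
  convert! (((hp.add ((hp.pow 2).const_mul 3)).add ((hp.pow 3).const_mul 2)).const_mul 3).sub
    ((hasDerivAt_id x).mul (((hp.add ((hp.pow 2).const_mul 7)).add
      ((hp.pow 3).const_mul 12)).add ((hp.pow 4).const_mul 6))) using 1
  simp [-inv_pow]
  generalize (Real.exp x - 1)⁻¹ = p
  ring

open scoped Nat in
/-- All Taylor coefficients of this function are nonnegative. -/
lemma sinh_cosh_combination_nonneg {u : ℝ} (hu : 0 ≤ u) :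
    0 ≤ 120 * u * Real.cosh (3 * u) + 1320 * u * Real.cosh u - 250 * Real.sinh (3 * u)
      - 700 * Real.sinh u + 2 * Real.sinh (5 * u) := by
  have h := (((((Real.hasSum_cosh (3 * u)).mul_left (120 * u)).add
    ((Real.hasSum_cosh u).mul_left (1320 * u))).sub
    ((Real.hasSum_sinh (3 * u)).mul_left 250)).sub
    ((Real.hasSum_sinh u).mul_left 700)).add ((Real.hasSum_sinh (5 * u)).mul_left 2)
  refine h.nonneg fun m => ?_
  have key : 0 ≤ 120 * (2 * m + 1) * (3 : ℝ) ^ (2 * m) + 1320 * (2 * m + 1)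
      - 250 * 3 ^ (2 * m + 1) - 700 + 2 * 5 ^ (2 * m + 1) := by
    rcases lt_or_ge m 3 with hm | hm
    · interval_cases m <;> norm_num
    · have h3 : (3 : ℝ) ≤ m := by exact_mod_cast hm
      have : (0 : ℝ) < 3 ^ (2 * m) := by positivity
      have : (0 : ℝ) < 5 ^ (2 * m + 1) := by positivity
      rw [pow_succ (3 : ℝ)]
      nlinarith
  have hf : ((2 * m + 1)! : ℝ) = (2 * m + 1) * (2 * m)! := by
    rw [Nat.factorial_succ]; push_cast; ring
  have hfp : (0 : ℝ) < (2 * m)! := by exact_mod_cast Nat.factorial_pos _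
  have : 0 ≤ u ^ (2 * m + 1) / (2 * m + 1)! * (120 * (2 * m + 1) * (3 : ℝ) ^ (2 * m)
      + 1320 * (2 * m + 1) - 250 * 3 ^ (2 * m + 1) - 700 + 2 * 5 ^ (2 * m + 1)) := by
    positivity
  refine this.trans_eq ?_
  rw [hf]
  simp only [mul_pow, pow_succ]
  field_simp

lemma iteratedDeriv_four_bernoulliGen_ge {x : ℝ} (hx : 0 < x) :
    0 ≤ iteratedDeriv 4 bernoulliGen x + 1 / 30 := by
  have h := sinh_cosh_combination_nonneg (half_pos hx).le
  rw [iteratedDeriv_four_bernoulliGen_of_pos hx]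
  set w := Real.exp (x / 2) with hw
  have hw1 : 1 < w := Real.one_lt_exp_iff.2 (half_pos hx)
  have hw0 : 0 < w := by positivity
  have hx2 : Real.exp x = w ^ 2 := by rw [hw, ← Real.exp_nat_mul]; congr 1; push_cast; ring
  have h3 : Real.exp (3 * (x / 2)) = w ^ 3 := by rw [hw, ← Real.exp_nat_mul]; norm_cast
  have h5 : Real.exp (5 * (x / 2)) = w ^ 5 := by rw [hw, ← Real.exp_nat_mul]; norm_cast
  simp only [Real.sinh_eq, Real.cosh_eq, Real.exp_neg, h3, h5, ← hw] at h
  have hy : 0 < w ^ 2 - 1 := by nlinarith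
  have hc : 0 < w ^ 5 / (30 * (w ^ 2 - 1) ^ 5) := by positivity
  refine (mul_nonneg hc.le h).trans_eq ?_
  rw [hx2]
  field_simp
  ring

open MeasureTheory

/-- Functions that are killed at infinity by every decaying exponential. -/
def IsSubexponential (f : ℝ → ℝ) : Prop :=
  ∀ t > 0, Tendsto (fun x => Real.exp (-(t * x)) * f x) atTop (𝓝 0)

lemma IsSubexponential.add {f g : ℝ → ℝ} (hf : IsSubexponential f) (hg : IsSubexponential g) :
    IsSubexponential (fun x => f x + g x) := fun t ht => by
  simpa [mul_add] using (hf t ht).add (hg t ht)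

lemma IsSubexponential.const_mul {f : ℝ → ℝ} (hf : IsSubexponential f) (c : ℝ) :
    IsSubexponential (fun x => c * f x) := fun t ht => by
  simpa [mul_left_comm] using (hf t ht).const_mul c

lemma isSubexponential_pow (n : ℕ) : IsSubexponential (fun x => x ^ n) := fun t ht => by
  simpa [mul_comm] using tendsto_rpow_mul_exp_neg_mul_atTop_nhds_zero n t ht

lemma IsSubexponential.integrableOn {f : ℝ → ℝ} (hf : IsSubexponential f) (hc : Continuous f)
    {t : ℝ} (ht : 0 < t) : IntegrableOn (fun x => Real.exp (-(t * x)) * f x) (Ioi 0) := by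
  refine integrable_of_isBigO_exp_neg (half_pos ht) (by fun_prop) ?_
  have h := (Asymptotics.isBigO_refl (fun x : ℝ => Real.exp (-(t / 2) * x)) atTop).mul
    ((hf (t / 2) (half_pos ht)).isBigO_one ℝ)
  simp only [mul_one, ← mul_assoc, ← Real.exp_add] at h
  convert! h using 4
  ring

lemma isSubexponential_iteratedDeriv_bernoulliGen (n : ℕ) :
    IsSubexponential (iteratedDeriv n bernoulliGen) := fun t ht => by
  obtain ⟨A, B, h⟩ := exists_iteratedDeriv_bernoulliGen_of_pos n
  have hp : Tendsto (fun x => (Real.exp x - 1)⁻¹) atTop (𝓝 0) :=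
    (tendsto_atTop_add_const_right _ (-1) Real.tendsto_exp_atTop).inv_tendsto_atTop
  have hlim := ((isSubexponential_pow 1 t ht).mul ((A.continuous.tendsto 0).comp hp)).add
    ((isSubexponential_pow 0 t ht).mul ((B.continuous.tendsto 0).comp hp))
  simp only [zero_mul, add_zero] at hlim
  refine hlim.congr' ?_
  filter_upwards [eventually_gt_atTop 0] with x hx
  simp only [h x hx, Function.comp_apply]
  ring

lemma continuous_iteratedDeriv_bernoulliGen (n : ℕ) :
    Continuous (iteratedDeriv n bernoulliGen) :=
  continuous_iff_continuousAt.2 fun x => (hasDerivAt_iteratedDeriv_bernoulliGen n x).continuousAt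

lemma integral_exp_neg_mul_pow (n : ℕ) {t : ℝ} (ht : 0 < t) :
    ∫ x in Ioi (0 : ℝ), Real.exp (-(t * x)) * x ^ n = n.factorial / t ^ (n + 1) := by
  have h := Real.integral_rpow_mul_exp_neg_mul_Ioi (a := n + 1) (by positivity) ht
  rw [Real.Gamma_nat_eq_factorial] at h
  simp only [add_sub_cancel_right, Real.rpow_natCast] at h
  simp only [mul_comm (Real.exp _), h]
  rw [← Nat.cast_succ, Real.rpow_natCast, one_div_pow, one_div_mul_eq_div]

lemma hasSum_exp_neg_mul (t : ℝ) {x : ℝ} (hx : 0 < x) :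
    HasSum (fun n : ℕ => Real.exp (-((t + n) * x)) * x ^ 1)
      (Real.exp (-(t * x)) * (bernoulliGen x + x)) := by
  have hlt : Real.exp (-x) < 1 := Real.exp_zero ▸ Real.exp_lt_exp.2 (neg_lt_zero.2 hx)
  have h := ((hasSum_geometric_of_lt_one (Real.exp_pos _).le hlt).mul_left
    (Real.exp (-(t * x)) * x))
  convert! h using 1
  · ext n
    rw [← Real.exp_nat_mul, mul_right_comm, ← Real.exp_add]
    ring_nf
  · rw [bernoulliGen_of_ne hx.ne', Real.exp_neg x]
    have h1 := exp_sub_one_ne_zero hx.ne'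
    have h2 : 1 - (Real.exp x)⁻¹ ≠ 0 := by
      rw [← Real.exp_neg]; linarith
    field_simp
    ring

lemma integral_exp_neg_mul_bernoulliGen_add {t : ℝ} (ht : 0 < t) :
    ∫ x in Ioi (0 : ℝ), Real.exp (-(t * x)) * (bernoulliGen x + x) = trigamma t := by
  have hpos : ∀ n : ℕ, 0 < t + n := fun n => by positivity
  have hint : ∀ n : ℕ, ∫ x in Ioi (0 : ℝ), Real.exp (-((t + n) * x)) * x ^ 1 =
      1 / (t + n) ^ 2 := fun n => by
    rw [integral_exp_neg_mul_pow 1 (hpos n)]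
    norm_num
  have hnorm : ∀ n : ℕ, ∫ x in Ioi (0 : ℝ), ‖Real.exp (-((t + n) * x)) * x ^ 1‖ =
      1 / (t + n) ^ 2 := fun n => by
    rw [← hint]
    refine setIntegral_congr_fun measurableSet_Ioi fun x hx => ?_
    have hx : 0 < x := hx
    exact Real.norm_of_nonneg (by positivity)
  have hsum : Summable fun n : ℕ => 1 / (t + n) ^ 2 := by
    have := (Real.summable_one_div_nat_add_rpow t 2).2 one_lt_two
    simpa [add_comm] using this
  have h := hasSum_integral_of_summable_integral_norm (μ := volume.restrict (Ioi (0 : ℝ)))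
    (F := fun (n : ℕ) x => Real.exp (-((t + n) * x)) * x ^ 1)
    (fun n => (isSubexponential_pow 1).integrableOn (by fun_prop) (hpos n))
    (by simpa only [hnorm] using hsum)
  simp only [hint] at h
  rw [trigamma, h.tsum_eq]
  exact setIntegral_congr_fun measurableSet_Ioi fun x hx => (hasSum_exp_neg_mul t hx).tsum_eq.symm

/-- The function whose Laplace transform is `Q`. -/
noncomputable def laplaceKernel (x : ℝ) : ℝ :=
  bernoulliGen x + x / 2 - 1 - x ^ 2 / 12 + x ^ 4 / 720

lemma continuous_laplaceKernel : Continuous laplaceKernel := by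
  have : Continuous bernoulliGen := (contDiff_bernoulliGen (n := 0)).continuous
  unfold laplaceKernel
  fun_prop

lemma isSubexponential_bernoulliGen : IsSubexponential bernoulliGen := by
  simpa using isSubexponential_iteratedDeriv_bernoulliGen 0

lemma integral_exp_neg_mul_laplaceKernel {t : ℝ} (ht : 0 < t) :
    ∫ x in Ioi (0 : ℝ), Real.exp (-(t * x)) * laplaceKernel x = Q t := by
  have hb : IntegrableOn (fun x => Real.exp (-(t * x)) * (bernoulliGen x + x)) (Ioi 0) := by
    have hc : Continuous bernoulliGen := (contDiff_bernoulliGen (n := 0)).continuous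
    refine IsSubexponential.integrableOn ?_ (by fun_prop) ht
    simpa using isSubexponential_bernoulliGen.add (isSubexponential_pow 1)
  have hp : ∀ n : ℕ, IntegrableOn (fun x => Real.exp (-(t * x)) * x ^ n) (Ioi 0) := fun n =>
    (isSubexponential_pow n).integrableOn (by fun_prop) ht
  have e : ∀ x : ℝ, Real.exp (-(t * x)) * laplaceKernel x =
      Real.exp (-(t * x)) * (bernoulliGen x + x) - Real.exp (-(t * x)) * x ^ 0
        - 1 / 2 * (Real.exp (-(t * x)) * x ^ 1) - 1 / 12 * (Real.exp (-(t * x)) * x ^ 2)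
        + 1 / 720 * (Real.exp (-(t * x)) * x ^ 4) := fun x => by
    unfold laplaceKernel; ring
  simp only [e]
  have i0 : IntegrableOn (fun x => Real.exp (-(t * x)) * (bernoulliGen x + x)
      - Real.exp (-(t * x)) * x ^ 0) (Ioi 0) := hb.sub (hp 0)
  have i1 : IntegrableOn (fun x => Real.exp (-(t * x)) * (bernoulliGen x + x)
      - Real.exp (-(t * x)) * x ^ 0 - 1 / 2 * (Real.exp (-(t * x)) * x ^ 1)) (Ioi 0) :=
    i0.sub ((hp 1).const_mul _)
  have i2 : IntegrableOn (fun x => Real.exp (-(t * x)) * (bernoulliGen x + x)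
      - Real.exp (-(t * x)) * x ^ 0 - 1 / 2 * (Real.exp (-(t * x)) * x ^ 1)
      - 1 / 12 * (Real.exp (-(t * x)) * x ^ 2)) (Ioi 0) :=
    i1.sub ((hp 2).const_mul _)
  rw [integral_add i2 ((hp 4).const_mul _), integral_sub i1 ((hp 2).const_mul _),
    integral_sub i0 ((hp 1).const_mul _), integral_sub hb (hp 0)]
  simp only [integral_const_mul, integral_exp_neg_mul_pow _ ht,
    integral_exp_neg_mul_bernoulliGen_add ht, Q, Nat.factorial]
  push_cast
  field_simp
  ring

/-- The fourth derivative of `laplaceKernel`. -/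
noncomputable def laplaceDensity (x : ℝ) : ℝ := iteratedDeriv 4 bernoulliGen x + 1 / 30

lemma continuous_laplaceDensity : Continuous laplaceDensity :=
  (continuous_iteratedDeriv_bernoulliGen 4).add continuous_const

lemma isSubexponential_laplaceDensity : IsSubexponential laplaceDensity := by
  unfold laplaceDensity
  simpa using (isSubexponential_iteratedDeriv_bernoulliGen 4).add
    ((isSubexponential_pow 0).const_mul (1 / 30))

lemma isSubexponential_laplaceKernel : IsSubexponential laplaceKernel := by
  have h := (((isSubexponential_bernoulliGen.add ((isSubexponential_pow 1).const_mul (1 / 2))).add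
    ((isSubexponential_pow 0).const_mul (-1))).add
    ((isSubexponential_pow 2).const_mul (-1 / 12))).add
    ((isSubexponential_pow 4).const_mul (1 / 720))
  convert! h using 2 with x
  unfold laplaceKernel
  ring

lemma integral_exp_neg_mul_laplaceDensity {t : ℝ} (ht : 0 < t) :
    ∫ x in Ioi (0 : ℝ), Real.exp (-(t * x)) * laplaceDensity x = t ^ 4 * Q t := by
  set k1 : ℝ → ℝ := fun x => iteratedDeriv 1 bernoulliGen x + 1 / 2 - x / 6 + x ^ 3 / 180
    with hk1
  set k2 : ℝ → ℝ := fun x => iteratedDeriv 2 bernoulliGen x - 1 / 6 + x ^ 2 / 60 with hk2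
  set k3 : ℝ → ℝ := fun x => iteratedDeriv 3 bernoulliGen x + x / 30 with hk3
  have d0 : ∀ x, HasDerivAt laplaceKernel (k1 x) x := fun x => by
    have h := hasDerivAt_iteratedDeriv_bernoulliGen 0 x
    rw [iteratedDeriv_zero] at h
    convert! (((h.add ((hasDerivAt_id x).div_const 2)).sub_const 1).sub
      ((hasDerivAt_pow 2 x).div_const 12)).add ((hasDerivAt_pow 4 x).div_const 720) using 1
    simp [hk1]
    ring
  have d1 : ∀ x, HasDerivAt k1 (k2 x) x := fun x => by
    convert! (((hasDerivAt_iteratedDeriv_bernoulliGen 1 x).add_const (1 / 2)).sub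
      ((hasDerivAt_id x).div_const 6)).add ((hasDerivAt_pow 3 x).div_const 180) using 1
    simp [hk2]
    ring
  have d2 : ∀ x, HasDerivAt k2 (k3 x) x := fun x => by
    convert! ((hasDerivAt_iteratedDeriv_bernoulliGen 2 x).sub_const (1 / 6)).add
      ((hasDerivAt_pow 2 x).div_const 60) using 1
    simp [hk3]
    ring
  have d3 : ∀ x, HasDerivAt k3 (laplaceDensity x) x := fun x =>
    (hasDerivAt_iteratedDeriv_bernoulliGen 3 x).add ((hasDerivAt_id x).div_const 30)
  have s1 : IsSubexponential k1 := by
    have h := (((isSubexponential_iteratedDeriv_bernoulliGen 1).add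
      ((isSubexponential_pow 0).const_mul (1 / 2))).add
      ((isSubexponential_pow 1).const_mul (-1 / 6))).add
      ((isSubexponential_pow 3).const_mul (1 / 180))
    convert! h using 2 with x
    simp only [hk1]
    ring
  have s2 : IsSubexponential k2 := by
    have h := ((isSubexponential_iteratedDeriv_bernoulliGen 2).add
      ((isSubexponential_pow 0).const_mul (-1 / 6))).add
      ((isSubexponential_pow 2).const_mul (1 / 60))
    convert! h using 2 with x
    simp only [hk2]
    ring
  have s3 : IsSubexponential k3 := by
    have h := (isSubexponential_iteratedDeriv_bernoulliGen 3).add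
      ((isSubexponential_pow 1).const_mul (1 / 30))
    convert! h using 2 with x
    simp only [hk3]
    ring
  set H : ℝ → ℝ := fun x => Real.exp (-(t * x)) *
    (k3 x + (t * k2 x + (t ^ 2 * k1 x + t ^ 3 * laplaceKernel x))) with hH
  have dH : ∀ x ∈ Ici (0 : ℝ), HasDerivAt H (Real.exp (-(t * x)) * laplaceDensity x
      - t ^ 4 * (Real.exp (-(t * x)) * laplaceKernel x)) x := fun x _ => by
    convert! ((hasDerivAt_id x).const_mul t).neg.exp.mul ((d3 x).add (((d2 x).const_mul t).add
      (((d1 x).const_mul (t ^ 2)).add ((d0 x).const_mul (t ^ 3))))) using 1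
    simp
    ring
  have i4 := isSubexponential_laplaceDensity.integrableOn continuous_laplaceDensity ht
  have i0 := (isSubexponential_laplaceKernel.integrableOn continuous_laplaceKernel ht).const_mul
    (t ^ 4)
  have lim : Tendsto H atTop (𝓝 0) := (s3.add ((s2.const_mul t).add
    ((s1.const_mul (t ^ 2)).add (isSubexponential_laplaceKernel.const_mul (t ^ 3))))) t ht
  have h := integral_Ioi_of_hasDerivAt_of_tendsto' dH (i4.sub i0) lim
  obtain ⟨b0, b1, b2, b3⟩ := iteratedDeriv_bernoulliGen_zero
  have H0 : H 0 = 0 := by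
    simp only [hH, hk1, hk2, hk3, laplaceKernel, b0, b1, b2, b3]
    norm_num
  rw [integral_sub i4 i0, integral_const_mul, integral_exp_neg_mul_laplaceKernel ht, H0] at h
  linarith

/-- The measure on `(0, ∞)` whose Laplace transform is `t ↦ t ^ 4 * Q t`. -/
noncomputable def laplaceMeasure : Measure ℝ :=
  (volume.restrict (Ioi 0)).withDensity fun x => ENNReal.ofReal (laplaceDensity x)

lemma toReal_ofReal_laplaceDensity {x : ℝ} (hx : x ∈ Ioi 0) :
    (ENNReal.ofReal (laplaceDensity x)).toReal = laplaceDensity x :=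
  ENNReal.toReal_ofReal (iteratedDeriv_four_bernoulliGen_ge hx)

lemma measurable_ofReal_laplaceDensity :
    Measurable fun x => ENNReal.ofReal (laplaceDensity x) :=
  continuous_laplaceDensity.measurable.ennreal_ofReal

open ProbabilityTheory

lemma mgf_laplaceMeasure {t : ℝ} (ht : 0 < t) :
    mgf (fun x => -x) laplaceMeasure t = t ^ 4 * Q t := by
  rw [mgf, laplaceMeasure, integral_withDensity_eq_integral_toReal_smul
    measurable_ofReal_laplaceDensity (ae_of_all _ fun _ => ENNReal.ofReal_lt_top),
    ← integral_exp_neg_mul_laplaceDensity ht]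
  refine setIntegral_congr_fun measurableSet_Ioi fun x hx => ?_
  simp [toReal_ofReal_laplaceDensity hx, mul_comm]

lemma mem_interior_integrableExpSet_laplaceMeasure {t : ℝ} (ht : 0 < t) :
    t ∈ interior (integrableExpSet (fun x => -x) laplaceMeasure) := by
  refine interior_maximal (fun u hu => ?_) isOpen_Ioi (show t ∈ Ioi 0 from ht)
  rw [integrableExpSet, mem_ofPred_eq, laplaceMeasure,
    integrable_withDensity_iff measurable_ofReal_laplaceDensity
      (ae_of_all _ fun _ => ENNReal.ofReal_lt_top)]
  refine IntegrableOn.congr_fun (isSubexponential_laplaceDensity.integrableOn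
    continuous_laplaceDensity hu) (fun x hx => ?_) measurableSet_Ioi
  simp [toReal_ofReal_laplaceDensity hx]

lemma eventuallyEq_mgf_laplaceMeasure {t : ℝ} (ht : 0 < t) :
    (fun t : ℝ => t ^ 4 * Q t) =ᶠ[𝓝 t] mgf (fun x => -x) laplaceMeasure := by
  filter_upwards [Ioi_mem_nhds ht] with u hu using (mgf_laplaceMeasure hu).symm

lemma analyticAt_pow_four_mul_Q {t : ℝ} (ht : 0 < t) :
    AnalyticAt ℝ (fun t : ℝ => t ^ 4 * Q t) t :=
  (analyticAt_mgf (mem_interior_integrableExpSet_laplaceMeasure ht)).congr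
    (eventuallyEq_mgf_laplaceMeasure ht).symm

lemma iteratedDeriv_pow_four_mul_Q (n : ℕ) {t : ℝ} (ht : 0 < t) :
    iteratedDeriv n (fun t : ℝ => t ^ 4 * Q t) t =
      ∫ x, (-x) ^ n * Real.exp (t * -x) ∂laplaceMeasure := by
  rw [(eventuallyEq_mgf_laplaceMeasure ht).iteratedDeriv_eq,
    iteratedDeriv_mgf (mem_interior_integrableExpSet_laplaceMeasure ht)]

lemma iteratedDeriv_pow_four_mul_Q_nonneg {n : ℕ} (hn : Even n) {t : ℝ} (ht : 0 < t) :
    0 ≤ iteratedDeriv n (fun t : ℝ => t ^ 4 * Q t) t := by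
  rw [iteratedDeriv_pow_four_mul_Q n ht]
  exact integral_nonneg fun x => mul_nonneg (hn.pow_nonneg _) (Real.exp_pos _).le

lemma iteratedDeriv_pow_four_mul_Q_nonpos {n : ℕ} (hn : Odd n) {t : ℝ} (ht : 0 < t) :
    iteratedDeriv n (fun t : ℝ => t ^ 4 * Q t) t ≤ 0 := by
  rw [iteratedDeriv_pow_four_mul_Q n ht]
  have hpos : ∀ᵐ x ∂laplaceMeasure, x ∈ Ioi (0 : ℝ) :=
    (withDensity_absolutelyContinuous _ _).ae_le (ae_restrict_mem measurableSet_Ioi)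
  refine integral_nonpos_of_ae ?_
  filter_upwards [hpos] with x hx
  exact mul_nonpos_of_nonpos_of_nonneg (hn.pow_nonpos (neg_nonpos.2 (le_of_lt hx)))
    (Real.exp_pos _).le

/-- The function `t ↦ t⁴ · Q(t)` is nonincreasing and convex on `(0, ∞)`, its even-order
derivatives are nonnegative and its odd-order derivatives are nonpositive on `(0, ∞)`. -/
theorem t4Q_antitone_convex_derivs :
    AntitoneOn (fun t : ℝ => t ^ 4 * Q t) (Ioi 0) ∧
      ConvexOn ℝ (Ioi 0) (fun t : ℝ => t ^ 4 * Q t) ∧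
      ∀ n : ℕ, ∀ t : ℝ, 0 < t →
        (Even n → 0 ≤ iteratedDeriv n (fun t : ℝ => t ^ 4 * Q t) t) ∧
        (Odd n → iteratedDeriv n (fun t : ℝ => t ^ 4 * Q t) t ≤ 0) := by
  refine ⟨?_, ?_, fun n t ht => ⟨fun hn => iteratedDeriv_pow_four_mul_Q_nonneg hn ht,
    fun hn => iteratedDeriv_pow_four_mul_Q_nonpos hn ht⟩⟩
  · refine antitoneOn_of_deriv_nonpos (convex_Ioi 0)
      (fun t ht => (analyticAt_pow_four_mul_Q ht).continuousAt.continuousWithinAt) ?_ ?_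
    · rw [interior_Ioi]
      exact fun t ht => (analyticAt_pow_four_mul_Q ht).differentiableAt.differentiableWithinAt
    · rw [interior_Ioi]
      intro t ht
      rw [← iteratedDeriv_one]
      exact iteratedDeriv_pow_four_mul_Q_nonpos odd_one ht
  · refine convexOn_of_deriv2_nonneg' (convex_Ioi 0)
      (fun t ht => (analyticAt_pow_four_mul_Q ht).differentiableAt.differentiableWithinAt)
      (fun t ht => (analyticAt_pow_four_mul_Q ht).deriv.differentiableAt.differentiableWithinAt)
      fun t ht => ?_
    rw [← iteratedDeriv_eq_iterate]
    exact iteratedDeriv_pow_four_mul_Q_nonneg even_two ht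
end
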